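/- arXiv:2106.15911 — 3 statements merged into one kernel-verified Lean document; each statement's English description precedes it below -/
import Mathlib

section
/- Let m ∈ ℕ and let p be a real polynomial with deg p ≤ m. Define c_k = (λ_k/(m+1)) Σ_{n=0}^{m} p(ξ_n) T_k(ξ_n) for k = 0, …, m, where ξ_n = cos((2n+1)π/(2(m+1))). Then p(x) = Σ_{k=0}^{m} c_k T_k(x) for all x ∈ ℝ, i.e., the discrete Chebyshev transform at the m+1 Chebyshev nodes reproduces every polynomial of degree at most m exactly. -/
open Real Finset

/-- The Chebyshev nodes of order `m+1` on `[-1,1]`: `ξ_n = cos((2n+1)π/(2(m+1)))`. -/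
noncomputable def chebNode (m n : ℕ) : ℝ :=
  Real.cos ((2 * (n : ℝ) + 1) * π / (2 * ((m : ℝ) + 1)))

/-- Evaluation of the `k`-th Chebyshev polynomial of the first kind at `x`. -/
noncomputable def chebT (k : ℕ) (x : ℝ) : ℝ :=
  (Polynomial.Chebyshev.T ℝ (k : ℤ)).eval x

/-- `λ_0 = 1` and `λ_k = 2` for `k ≥ 1`. -/
def chebLambda (k : ℕ) : ℝ := if k = 0 then 1 else 2

/-- The values of `T_k` at the Chebyshev nodes of order `m + 1` sum to zero unless
`2 * (m + 1)` divides `k`. -/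
theorem sum_eval_T_chebNode_of_not_dvd {m : ℕ} {k : ℤ}
    (hk : ¬ (2 * (m + 1 : ℕ) : ℤ) ∣ k) :
    ∑ n ∈ range (m + 1), (Polynomial.Chebyshev.T ℝ k).eval (chebNode m n) = 0 := by
  have h := Polynomial.Chebyshev.sumZeroes_T_of_not_dvd hk
  rw [Polynomial.Chebyshev.sumZeroes, mul_eq_zero_iff_left (by positivity)] at h
  rw [← h]
  refine sum_congr rfl fun n _ ↦ ?_
  rw [chebNode, div_mul_eq_mul_div, Nat.cast_succ]

/-- Discrete orthogonality of the Chebyshev polynomials at the Chebyshev nodes. -/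
theorem chebLambda_div_mul_sum_chebT_mul_chebT {m j k : ℕ} (hj : j ≤ m) (hk : k ≤ m) :
    chebLambda k / ((m : ℝ) + 1) *
      ∑ n ∈ range (m + 1), chebT j (chebNode m n) * chebT k (chebNode m n) =
    if j = k then 1 else 0 := by
  have hm : (m : ℝ) + 1 ≠ 0 := by positivity
  have hprod (x : ℝ) : chebT j x * chebT k x =
      ((Polynomial.Chebyshev.T ℝ (j + k)).eval x +
        (Polynomial.Chebyshev.T ℝ (j - k)).eval x) / 2 := by
    have h := congrArg (Polynomial.eval x) (Polynomial.Chebyshev.T_mul_T ℝ j k)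
    simp only [Polynomial.eval_mul, Polynomial.eval_add, Polynomial.eval_ofNat] at h
    unfold chebT
    linarith
  have hzero {i : ℤ} (hi : i ≠ 0) (hlt : |i| < 2 * (m + 1 : ℕ)) :
      ∑ n ∈ range (m + 1), (Polynomial.Chebyshev.T ℝ i).eval (chebNode m n) = 0 :=
    sum_eval_T_chebNode_of_not_dvd fun hdvd ↦ hi (Int.eq_zero_of_abs_lt_dvd hdvd hlt)
  simp_rw [hprod]
  rw [← sum_div, sum_add_distrib]
  split_ifs with hjk
  · subst hjk
    obtain rfl | hj0 := eq_or_ne j 0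
    · simp [chebLambda, hm]
    · rw [hzero (by lia) (by rw [abs_lt]; lia)]
      simp [chebLambda, hj0, hm]
  · rw [hzero (by lia) (by rw [abs_lt]; lia), hzero (by lia) (by rw [abs_lt]; lia)]
    simp

/-- Every real polynomial of degree at most `m` is a combination of `T_0, …, T_m`. -/
theorem exists_eval_eq_sum_chebT {m : ℕ} {p : Polynomial ℝ} (hp : p.natDegree ≤ m) :
    ∃ c : ℕ → ℝ, ∀ x, p.eval x = ∑ j ∈ range (m + 1), c j * chebT j x := by
  have hmem : p ∈ Polynomial.degreeLT ℝ (m + 1) := by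
    rw [Polynomial.mem_degreeLT]
    exact (Polynomial.degree_le_of_natDegree_le hp).trans_lt (by exact_mod_cast m.lt_succ_self)
  rw [← Polynomial.Sequence.span_degreeLT (Polynomial.Chebyshev.chebyshevTsequence ℝ)
      (by simp), show Set.Iio (m + 1) = range (m + 1) by simp,
    Submodule.mem_span_image_finset_iff_exists_fun'] at hmem
  obtain ⟨c, rfl⟩ := hmem
  refine ⟨c, fun x ↦ ?_⟩
  simp_rw [Polynomial.eval_finsetSum, Polynomial.eval_smul, smul_eq_mul]
  rfl

/-- Let `p` be a real polynomial with `deg p ≤ m` and define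
`c_k = (λ_k/(m+1)) Σ_{n=0}^{m} p(ξ_n) T_k(ξ_n)` for `k = 0, …, m`. Then
`p(x) = Σ_{k=0}^{m} c_k T_k(x)` for all `x ∈ ℝ`: the discrete Chebyshev transform at
the `m+1` Chebyshev nodes reproduces every polynomial of degree at most `m` exactly. -/
theorem discrete_chebyshev_transform_exact (m : ℕ) (p : Polynomial ℝ)
    (hp : p.natDegree ≤ m) (x : ℝ) :
    p.eval x =
      ∑ k ∈ Finset.range (m + 1),
        (chebLambda k / ((m : ℝ) + 1) *
          ∑ n ∈ Finset.range (m + 1), p.eval (chebNode m n) * chebT k (chebNode m n)) *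
          chebT k x := by
  obtain ⟨c, hc⟩ := exists_eval_eq_sum_chebT hp
  rw [hc]
  refine sum_congr rfl fun k hk ↦ ?_
  congr 1
  simp_rw [hc, sum_mul]
  rw [sum_comm]
  simp_rw [mul_assoc (c _), ← mul_sum]
  rw [mul_sum]
  simp_rw [mul_left_comm _ (c _)]
  rw [sum_congr rfl fun j hj ↦ by rw [chebLambda_div_mul_sum_chebT_mul_chebT
    (mem_range_succ_iff.mp hj) (mem_range_succ_iff.mp hk)]]
  simp [mem_range.mp hk]
end

section
/- Let m ∈ ℕ and let X_c = (a_c, b_c] and X_p = (a_p, b_p] be nonempty intervals. For ν ∈ {0, …, m} define q_{κ,ν}(X_c, X_p) = (λ_κ/(m+1)) Σ_{n=0}^{m} T_{X_p,ν}(ξ_{X_c,n}) T_{X_c,κ}(ξ_{X_c,n}) for κ = 0, …, m. Then (exactness of the one-dimensional spatial M2M operation): (i) q_{κ,ν}(X_c, X_p) = 0 for all κ with ν < κ ≤ m, and (ii) T_{X_p,ν}(y) = Σ_{κ=0}^{ν} q_{κ,ν}(X_c, X_p) T_{X_c,κ}(y) for all y ∈ ℝ. -/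
open Real Finset

/-- The Chebyshev node `ξ_n` transformed to the interval `(lo, hi]` by the increasing
affine map `φ_{(lo,hi]}` from `[-1,1]` onto `[lo,hi]`. -/
noncomputable def transChebNode (m : ℕ) (lo hi : ℝ) (n : ℕ) : ℝ :=
  (lo + hi) / 2 + (hi - lo) / 2 * chebNode m n

/-- The transformed Chebyshev polynomial `T_{(lo,hi],k} = T_k ∘ φ_{(lo,hi]}⁻¹`. -/
noncomputable def transChebT (k : ℕ) (lo hi y : ℝ) : ℝ :=
  chebT k ((2 * y - (lo + hi)) / (hi - lo))

/-- The one-dimensional spatial M2M coefficients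
`q_{κ,ν}(X_c, X_p) = (λ_κ/(m+1)) Σ_{n=0}^{m} T_{X_p,ν}(ξ_{X_c,n}) T_{X_c,κ}(ξ_{X_c,n})`
for `X_c = (ac, bc]` and `X_p = (ap, bp]`. -/
noncomputable def m2mCoeff (m : ℕ) (ac bc ap bp : ℝ) (κ ν : ℕ) : ℝ :=
  chebLambda κ / ((m : ℝ) + 1) *
    ∑ n ∈ Finset.range (m + 1),
      transChebT ν ap bp (transChebNode m ac bc n) *
        transChebT κ ac bc (transChebNode m ac bc n)

open Polynomial Polynomial.Chebyshev in
/-- The values of `T_k` at the Chebyshev nodes of order `m + 1` sum to zero unless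
`2 * (m + 1)` divides `k`. -/
lemma sum_eval_T_chebNode_eq_zero {m : ℕ} {k : ℤ} (hk : ¬ (2 * ((m : ℤ) + 1)) ∣ k) :
    ∑ n ∈ Finset.range (m + 1), (T ℝ k).eval (chebNode m n) = 0 := by
  have h := sumZeroes_T_of_not_dvd (n := m + 1) (k := k) (by exact_mod_cast hk)
  rw [sumZeroes, mul_eq_zero_iff_left (by positivity)] at h
  rw [← h]
  refine Finset.sum_congr rfl fun n _ => ?_
  rw [chebNode]
  congr 2
  push_cast
  ring

/-- Discrete orthogonality of the Chebyshev polynomials at the Chebyshev nodes. -/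
lemma chebLambda_mul_sum_chebT_mul_chebT {m i j : ℕ} (hi : i ≤ m) (hj : j ≤ m) :
    chebLambda j / ((m : ℝ) + 1) *
      ∑ n ∈ Finset.range (m + 1), chebT i (chebNode m n) * chebT j (chebNode m n) =
        if i = j then 1 else 0 := by
  have hm : (m : ℝ) + 1 ≠ 0 := by positivity
  have not_dvd : ∀ k : ℤ, k ≠ 0 → |k| < 2 * ((m : ℤ) + 1) → ¬ (2 * ((m : ℤ) + 1)) ∣ k :=
    fun k hk hlt hdvd => hk (Int.eq_zero_of_abs_lt_dvd hdvd hlt)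
  have hprod : ∀ x : ℝ, chebT i x * chebT j x =
      ((Polynomial.Chebyshev.T ℝ (i + j : ℤ)).eval x +
        (Polynomial.Chebyshev.T ℝ (i - j : ℤ)).eval x) / 2 := fun x => by
    have h := congrArg (Polynomial.eval x) (Polynomial.Chebyshev.T_mul_T ℝ (i : ℤ) (j : ℤ))
    simp only [Polynomial.eval_mul, Polynomial.eval_add, Polynomial.eval_ofNat] at h
    simp only [chebT]
    linarith
  simp_rw [hprod]
  rw [← Finset.sum_div, Finset.sum_add_distrib]
  split_ifs with h
  · subst h
    rcases Nat.eq_zero_or_pos i with rfl | hpos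
    · simp [chebLambda]
      field_simp
    · rw [sum_eval_T_chebNode_eq_zero (not_dvd _ (by omega) (by rw [abs_lt]; omega))]
      simp [chebLambda, hpos.ne', hm]
  · rw [sum_eval_T_chebNode_eq_zero (not_dvd _ (by omega) (by rw [abs_lt]; omega)),
      sum_eval_T_chebNode_eq_zero (not_dvd _ (by omega) (by rw [abs_lt]; omega))]
    simp

open Polynomial in
/-- An affine substitution in `T_ν` is a linear combination of `T_0, …, T_ν`. -/
lemma exists_chebT_affine_eq_sum (ν : ℕ) (r s : ℝ) :
    ∃ c : ℕ → ℝ, ∀ x : ℝ,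
      chebT ν (r * x + s) = ∑ i ∈ Finset.range (ν + 1), c i * chebT i x := by
  have hmem : (Chebyshev.T ℝ (ν : ℤ)).comp (C r * X + C s) ∈ degreeLT ℝ (ν + 1) := by
    rw [mem_degreeLT]
    refine lt_of_le_of_lt degree_le_natDegree ?_
    rw [Nat.cast_lt, Nat.lt_succ_iff]
    refine natDegree_comp_le.trans ?_
    rw [Chebyshev.natDegree_T, Int.natAbs_natCast]
    exact (Nat.mul_le_mul_left ν natDegree_linear_le).trans (mul_one ν).le
  rw [← Sequence.span_degreeLT (Chebyshev.chebyshevTsequence ℝ) (by simp),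
    show Set.Iio (ν + 1) = Finset.range (ν + 1) by simp,
    Submodule.mem_span_image_finset_iff_exists_fun'] at hmem
  obtain ⟨c, hc⟩ := hmem
  refine ⟨c, fun x => ?_⟩
  have h := congrArg (eval x) hc
  simp only [eval_finsetSum, eval_smul, eval_comp, eval_add, eval_mul, eval_C, eval_X,
    smul_eq_mul] at h
  exact h.symm

lemma transChebT_transChebNode (m k n : ℕ) {lo hi : ℝ} (h : lo < hi) :
    transChebT k lo hi (transChebNode m lo hi n) = chebT k (chebNode m n) := by
  have : hi - lo ≠ 0 := (sub_pos.mpr h).ne'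
  rw [transChebT, transChebNode]
  congr 1
  field_simp
  ring

/-- A Chebyshev polynomial transformed to one interval is a linear combination of the
Chebyshev polynomials of at most the same degree transformed to another interval. -/
lemma exists_transChebT_eq_sum (ν : ℕ) {ac bc : ℝ} (ap bp : ℝ) (hc : ac < bc) :
    ∃ c : ℕ → ℝ, ∀ y : ℝ,
      transChebT ν ap bp y = ∑ i ∈ Finset.range (ν + 1), c i * transChebT i ac bc y := by
  obtain ⟨c, h⟩ := exists_chebT_affine_eq_sum ν ((bc - ac) / (bp - ap))
    ((ac + bc - (ap + bp)) / (bp - ap))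
  refine ⟨c, fun y => ?_⟩
  have : bc - ac ≠ 0 := (sub_pos.mpr hc).ne'
  simp only [transChebT]
  rw [← h]
  congr 1
  rw [div_mul_div_comm, mul_comm (bp - ap), mul_div_mul_left _ _ this, ← add_div]
  ring

/-- The M2M coefficients recover the coefficients of an expansion of degree at most `m`. -/
lemma m2mCoeff_eq_of_transChebT_eq_sum {m ν κ : ℕ} {ac bc ap bp : ℝ} (hc : ac < bc)
    (hν : ν ≤ m) (hκ : κ ≤ m) {c : ℕ → ℝ}
    (h : ∀ y : ℝ,
      transChebT ν ap bp y = ∑ i ∈ Finset.range (ν + 1), c i * transChebT i ac bc y) :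
    m2mCoeff m ac bc ap bp κ ν = if κ ∈ Finset.range (ν + 1) then c κ else 0 := by
  simp_rw [m2mCoeff, h, transChebT_transChebNode _ _ _ hc, Finset.sum_mul]
  rw [Finset.sum_comm, Finset.mul_sum, ← Finset.sum_ite_eq' (Finset.range (ν + 1)) κ c]
  refine Finset.sum_congr rfl fun i hi => ?_
  have hi' : i ≤ m := (Nat.lt_succ_iff.mp (Finset.mem_range.mp hi)).trans hν
  simp_rw [mul_assoc (c i), ← Finset.mul_sum]
  rw [mul_left_comm, chebLambda_mul_sum_chebT_mul_chebT hi' hκ]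
  simp


/-- exactness of the one-dimensional spatial M2M operation. For nonempty
intervals `X_c = (a_c, b_c]`, `X_p = (a_p, b_p]` and `ν ∈ {0, …, m}`:
(i) `q_{κ,ν}(X_c, X_p) = 0` for all `κ` with `ν < κ ≤ m`, and
(ii) `T_{X_p,ν}(y) = Σ_{κ=0}^{ν} q_{κ,ν}(X_c, X_p) T_{X_c,κ}(y)` for all `y ∈ ℝ`. -/
theorem spatial_m2m_exact (m : ℕ) (ac bc ap bp : ℝ)
    (hc : ac < bc) (hp : ap < bp) (ν : ℕ) (hν : ν ≤ m) :
    (∀ κ : ℕ, ν < κ → κ ≤ m → m2mCoeff m ac bc ap bp κ ν = 0) ∧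
    (∀ y : ℝ, transChebT ν ap bp y =
      ∑ κ ∈ Finset.range (ν + 1), m2mCoeff m ac bc ap bp κ ν * transChebT κ ac bc y) := by
  obtain ⟨c, h⟩ := exists_transChebT_eq_sum ν ap bp hc
  refine ⟨fun κ hlt hκ => ?_, fun y => ?_⟩
  · rw [m2mCoeff_eq_of_transChebT_eq_sum hc hν hκ h, if_neg (by simpa using hlt)]
  · rw [h]
    refine Finset.sum_congr rfl fun κ hκ => ?_
    have hκm : κ ≤ m := (Nat.lt_succ_iff.mp (Finset.mem_range.mp hκ)).trans hν
    rw [m2mCoeff_eq_of_transChebT_eq_sum hc hν hκm h, if_pos hκ]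
end

section
/- Let m ∈ ℕ, let I_p = (c, d] be an interval with c < e < d, and set I_1 = (c, e] and I_2 = (e, d]. Let f : ℝ → ℝ be integrable on (c, d]. For an interval J define the moments μ_a(J) = ∫_J f(τ) L_{J,a}(τ) dτ for a = 0, …, m. Then the temporal M2M operation is exact: for every a_p ∈ {0, …, m}, μ_{a_p}(I_p) = Σ_{c∈{1,2}} Σ_{a_c=0}^{m} L_{I_p,a_p}(ξ_{I_c,a_c}) · μ_{a_c}(I_c). -/
open Real Finset MeasureTheory

/-- The Lagrange polynomial `L_{J,b}(t) = ∏_{k≠b} (t − ξ_{J,k})/(ξ_{J,b} − ξ_{J,k})`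
for the transformed Chebyshev nodes on `J = (lo, hi]`. -/
noncomputable def lagrangeCheb (m : ℕ) (lo hi : ℝ) (b : ℕ) (t : ℝ) : ℝ :=
  ∏ k ∈ (Finset.range (m + 1)).erase b,
    (t - transChebNode m lo hi k) / (transChebNode m lo hi b - transChebNode m lo hi k)

/-- The moments `μ_a(J) = ∫_J f(τ) L_{J,a}(τ) dτ` for `J = (lo, hi]`. -/
noncomputable def moment (m : ℕ) (f : ℝ → ℝ) (lo hi : ℝ) (a : ℕ) : ℝ :=
  ∫ τ in Set.Ioc lo hi, f τ * lagrangeCheb m lo hi a τ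

lemma chebNode_injOn (m : ℕ) : Set.InjOn (chebNode m) (Finset.range (m + 1)) := by
  have hmem : ∀ i ∈ Finset.range (m + 1),
      (2 * (i : ℝ) + 1) * π / (2 * ((m : ℝ) + 1)) ∈ Set.Icc 0 π := by
    intro i hi
    have hi' : (i : ℝ) ≤ m := by
      exact_mod_cast Nat.lt_succ_iff.mp (Finset.mem_range.mp hi)
    refine ⟨by positivity, ?_⟩
    rw [div_le_iff₀ (by positivity)]
    nlinarith [Real.pi_pos]
  intro i hi j hj hij
  have h := Real.injOn_cos (hmem i hi) (hmem j hj) hij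
  field_simp at h
  have hij' : (i : ℝ) = j := by linarith
  exact_mod_cast hij'

lemma transChebNode_injOn (m : ℕ) {lo hi : ℝ} (h : lo < hi) :
    Set.InjOn (transChebNode m lo hi) (Finset.range (m + 1)) := by
  intro i hi' j hj hij
  refine chebNode_injOn m hi' hj (mul_left_cancel₀ (a := (hi - lo) / 2) (by linarith) ?_)
  simpa [transChebNode] using hij

lemma eval_basis_transChebNode (m : ℕ) (lo hi : ℝ) (b : ℕ) (t : ℝ) :
    (Lagrange.basis (Finset.range (m + 1)) (transChebNode m lo hi) b).eval t =
      lagrangeCheb m lo hi b t := by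
  simp [Lagrange.basis, Lagrange.basisDivisor, lagrangeCheb, Polynomial.eval_prod,
    div_eq_inv_mul]

lemma continuous_lagrangeCheb (m : ℕ) (lo hi : ℝ) (b : ℕ) :
    Continuous (lagrangeCheb m lo hi b) :=
  (Lagrange.basis (Finset.range (m + 1)) (transChebNode m lo hi) b).continuous.congr
    (eval_basis_transChebNode m lo hi b)

/-- Interpolation at the Chebyshev nodes of any interval reproduces the Lagrange polynomials of
any other interval. -/
lemma lagrangeCheb_eq_sum (m : ℕ) {lo hi lo' hi' : ℝ} (h : lo < hi) (h' : lo' < hi')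
    {b : ℕ} (hb : b ≤ m) (t : ℝ) :
    lagrangeCheb m lo hi b t = ∑ a ∈ Finset.range (m + 1),
      lagrangeCheb m lo hi b (transChebNode m lo' hi' a) * lagrangeCheb m lo' hi' a t := by
  have hdeg : (Lagrange.basis (Finset.range (m + 1)) (transChebNode m lo hi) b).degree <
      (#(Finset.range (m + 1)) : ℕ) := by
    rw [Lagrange.degree_basis (transChebNode_injOn m h) (by simpa [Nat.lt_succ_iff] using hb)]
    simp only [Finset.card_range, Nat.add_sub_cancel]
    exact_mod_cast Nat.lt_succ_self m
  have key := congrArg (Polynomial.eval t)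
    (Lagrange.eq_interpolate (transChebNode_injOn m h') hdeg)
  simpa [Lagrange.interpolate_apply, Polynomial.eval_finsetSum, eval_basis_transChebNode] using key

lemma integrableOn_mul_lagrangeCheb (m : ℕ) (lo hi : ℝ) (b : ℕ) {f : ℝ → ℝ} {x y : ℝ}
    (hf : IntegrableOn f (Set.Ioc x y)) :
    IntegrableOn (fun τ => f τ * lagrangeCheb m lo hi b τ) (Set.Ioc x y) :=
  hf.mul_continuousOn_of_subset (continuous_lagrangeCheb m lo hi b).continuousOn
    measurableSet_Ioc isCompact_Icc Set.Ioc_subset_Icc_self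

lemma setIntegral_mul_lagrangeCheb (m : ℕ) {lo hi lo' hi' : ℝ} (h : lo < hi) (h' : lo' < hi')
    {b : ℕ} (hb : b ≤ m) {f : ℝ → ℝ} (hf : IntegrableOn f (Set.Ioc lo' hi')) :
    ∫ τ in Set.Ioc lo' hi', f τ * lagrangeCheb m lo hi b τ =
      ∑ a ∈ Finset.range (m + 1),
        lagrangeCheb m lo hi b (transChebNode m lo' hi' a) * moment m f lo' hi' a := by
  simp only [moment, ← integral_const_mul]
  rw [← integral_finsetSum _ fun a _ =>
    (integrableOn_mul_lagrangeCheb m lo' hi' a hf).const_mul _]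
  refine integral_congr_ae (Filter.Eventually.of_forall fun τ => ?_)
  dsimp only
  rw [lagrangeCheb_eq_sum m h h' hb τ, Finset.mul_sum]
  exact Finset.sum_congr rfl fun a _ => by ring

/-- exactness of the temporal M2M operation. Let `I_p = (c, d]` with
`c < e < d`, `I_1 = (c, e]`, `I_2 = (e, d]`, and let `f` be integrable on `(c, d]`.
Then for every `a_p ∈ {0, …, m}`,
`μ_{a_p}(I_p) = Σ_{c∈{1,2}} Σ_{a_c=0}^{m} L_{I_p,a_p}(ξ_{I_c,a_c}) · μ_{a_c}(I_c)`. -/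
theorem temporal_m2m_exact (m : ℕ) (c e d : ℝ) (h1 : c < e) (h2 : e < d)
    (f : ℝ → ℝ) (hf : IntegrableOn f (Set.Ioc c d)) (ap : ℕ) (hap : ap ≤ m) :
    moment m f c d ap =
      (∑ a1 ∈ Finset.range (m + 1),
        lagrangeCheb m c d ap (transChebNode m c e a1) * moment m f c e a1) +
      (∑ a2 ∈ Finset.range (m + 1),
        lagrangeCheb m c d ap (transChebNode m e d a2) * moment m f e d a2) := by
  have hf1 : IntegrableOn f (Set.Ioc c e) := hf.mono_set (Set.Ioc_subset_Ioc_right h2.le)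
  have hf2 : IntegrableOn f (Set.Ioc e d) := hf.mono_set (Set.Ioc_subset_Ioc_left h1.le)
  have hcd : c < d := h1.trans h2
  rw [← setIntegral_mul_lagrangeCheb m hcd h1 hap hf1,
    ← setIntegral_mul_lagrangeCheb m hcd h2 hap hf2, moment, ← Set.Ioc_union_Ioc_eq_Ioc h1.le h2.le]
  exact setIntegral_union (Set.Ioc_disjoint_Ioc_of_le le_rfl) measurableSet_Ioc
    (integrableOn_mul_lagrangeCheb m c d ap hf1) (integrableOn_mul_lagrangeCheb m c d ap hf2)
end
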